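/- For every balayage π, the map Φ maps P_MC^π(𝒮) bijectively onto 𝒟(π), and the restriction Φ : P_MC^π(𝒮) → 𝒟(π) is an affine homeomorphism: it preserves convex combinations and is a continuous bijection with continuous inverse. -/

import Mathlib

open MeasureTheory Filter
open scoped ENNReal NNReal

namespace VMCPaper

abbrev Path : Type := ℕ → ℕ

def staircaseSet : Set Path :=
  {S | (∀ N, S N ≤ N) ∧ ∀ N, S (N + 1) = S N ∨ S (N + 1) = N + 1}

noncomputable def pr {α : Type*} [MeasurableSpace α] (μ : Measure α) (A : Set α) : ℝ :=
  (μ A).toReal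

def IsSMC (μ : Measure Path) : Prop :=
  IsProbabilityMeasure μ ∧ μ staircaseSet = 1 ∧
  ∀ (N : ℕ) (a : ℕ → ℕ),
    0 < pr μ {S | ∀ i ≤ N, S i = a i} →
    pr μ {S | (∀ i ≤ N, S i = a i) ∧ S (N + 1) = a (N + 1)} /
        pr μ {S | ∀ i ≤ N, S i = a i}
      = pr μ {S | S N = a N ∧ S (N + 1) = a (N + 1)} / pr μ {S | S N = a N}

noncomputable def marginals (μ : Measure Path) : ℕ → ℕ → ℝ :=
  fun N a => pr μ {S | S N = a}

def D : Set (ℕ → ℕ → ℝ) :=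
  {ν | (∀ N a, 0 ≤ ν N a) ∧ (∀ N a, N < a → ν N a = 0) ∧
       (∀ N, ∑ a ∈ Finset.range (N + 1), ν N a = 1) ∧
       ∀ N a, a ≤ N → ν (N + 1) a ≤ ν N a}

def PMC : Set (ProbabilityMeasure Path) := {μ | IsSMC (μ : Measure Path)}

def IsBalayage (π : ℕ → ℕ → ℝ) : Prop :=
  (∀ N a, 0 ≤ π N a) ∧ (∀ N a, N < a → π N a = 0) ∧
  ∀ N, ∑ a ∈ Finset.range (N + 1), π N a = 1

def Dpi (π : ℕ → ℕ → ℝ) : Set (ℕ → ℕ → ℝ) :=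
  {ν | ν ∈ D ∧ ∀ N a, a ≤ N → ν N a = ν (N + 1) a + ν (N + 1) (N + 1) * π N a}

def PMCpi (π : ℕ → ℕ → ℝ) : Set (Measure Path) :=
  {μ | IsSMC μ ∧ ∀ N a, a ≤ N →
    0 < pr μ {S | S (N + 1) = N + 1} →
    pr μ {S | S N = a ∧ S (N + 1) = N + 1} / pr μ {S | S (N + 1) = N + 1} = π N a}

def pathTail : MeasurableSpace Path :=
  ⨅ N : ℕ, MeasurableSpace.comap (fun (S : Path) (i : ℕ) => S (N + i)) inferInstance

def HasTrivialTail (μ : Measure Path) : Prop :=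
  ∀ A : Set Path, MeasurableSet[pathTail] A → μ A = 0 ∨ μ A = 1

def AffineOn {E : Type*} [AddCommMonoid E] [Module ℝ E] (f : E → ℝ) (K : Set E) : Prop :=
  ∀ x ∈ K, ∀ y ∈ K, ∀ t : ℝ, 0 ≤ t → t ≤ 1 →
    f (t • x + (1 - t) • y) = t * f x + (1 - t) * f y

def RepresentsOn {E : Type*} [AddCommMonoid E] [Module ℝ E] [TopologicalSpace E]
    [MeasurableSpace E] (m : Measure E) (K : Set E) (x : E) : Prop :=
  ∀ f : E → ℝ, ContinuousOn f K → AffineOn f K → f x = ∫ y, f y ∂m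

def IsChoquetSimplex {E : Type*} [AddCommMonoid E] [Module ℝ E] [TopologicalSpace E]
    [MeasurableSpace E] (K : Set E) : Prop :=
  ∀ x ∈ K, ∃! m : Measure E,
    IsProbabilityMeasure m ∧ m (Set.extremePoints ℝ K) = 1 ∧ RepresentsOn m K x

noncomputable def hitTime (x : Path) (A : Set ℕ) : ℕ → ℕ∞
  | 0 => ⨅ i ∈ {i : ℕ | x i ∈ A}, (i : ℕ∞)
  | k + 1 => ⨅ i ∈ {i : ℕ | hitTime x A k < (i : ℕ∞) ∧ x i ∈ A}, (i : ℕ∞)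

noncomputable def proj (N : ℕ) (x : Path) : Path := fun i =>
  if hitTime x {a | a ≤ N} i = ⊤ then 0 else x (hitTime x {a | a ≤ N} i).toNat

def pathSpace (N : ℕ) : Set Path :=
  {x | (∀ i, x i ≤ N) ∧ ∀ i, x i = 0 → ∀ j, i ≤ j → x j = 0}

def fullPathSpace : Set Path := {x | ∀ i, x i = 0 → ∀ j, i ≤ j → x j = 0}

def IsMarkovChain {Ω : Type*} [MeasurableSpace Ω] (P : Measure Ω) (Y : ℕ → Ω → ℕ) : Prop :=
  (∀ i, Measurable (Y i)) ∧
  (∀ (n : ℕ) (b : ℕ → ℕ),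
    0 < (P {ω | ∀ i ≤ n, Y i ω = b i}).toReal →
    (P {ω | (∀ i ≤ n, Y i ω = b i) ∧ Y (n + 1) ω = b (n + 1)}).toReal /
        (P {ω | ∀ i ≤ n, Y i ω = b i}).toReal
      = (P {ω | Y n ω = b n ∧ Y (n + 1) ω = b (n + 1)}).toReal /
        (P {ω | Y n ω = b n}).toReal) ∧
  (∀ m n b c : ℕ,
    0 < (P {ω | Y m ω = b}).toReal → 0 < (P {ω | Y n ω = b}).toReal →
    (P {ω | Y m ω = b ∧ Y (m + 1) ω = c}).toReal / (P {ω | Y m ω = b}).toReal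
      = (P {ω | Y n ω = b ∧ Y (n + 1) ω = c}).toReal / (P {ω | Y n ω = b}).toReal)

def IsVMC {Ω : Type*} [MeasurableSpace Ω] (P : Measure Ω) (X : Ω → ℕ → Path) : Prop :=
  IsProbabilityMeasure P ∧
  Measurable X ∧
  (∀ ω N, X ω N ∈ pathSpace N) ∧
  (∀ ω N, proj N (X ω (N + 1)) = X ω N) ∧
  ∀ N, IsMarkovChain P (fun i ω => X ω N i)

def S0 {Ω : Type*} (X : Ω → ℕ → Path) (N : ℕ) (ω : Ω) : ℕ := X ω N 0

noncomputable def Vis {Ω : Type*} (X : Ω → ℕ → Path) (a : ℕ) (ω : Ω) : ℕ∞ :=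
  {k : ℕ | hitTime (X ω a) {a} k ≠ ⊤}.encard

open scoped Classical in
noncomputable def Sak {Ω : Type*} (X : Ω → ℕ → Path) (a k N : ℕ) (ω : Ω) : ℕ :=
  if (k : ℕ∞) < Vis X a ω ∧ hitTime (X ω N) {a} k ≠ ⊤ then
    X ω N ((hitTime (X ω N) {a} k).toNat + 1)
  else 0

def InfinitelyVisited {Ω : Type*} [MeasurableSpace Ω] (P : Measure Ω)
    (X : Ω → ℕ → Path) (a : ℕ) : Prop := P {ω | Vis X a ω = ⊤} = 1

def OnceVisited {Ω : Type*} [MeasurableSpace Ω] (P : Measure Ω)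
    (X : Ω → ℕ → Path) (a : ℕ) : Prop := P {ω | Vis X a ω = 1} = 1

def NeverVisited {Ω : Type*} [MeasurableSpace Ω] (P : Measure Ω)
    (X : Ω → ℕ → Path) (a : ℕ) : Prop := P {ω | Vis X a ω = 0} = 1

def RandomlyVisited {Ω : Type*} [MeasurableSpace Ω] (P : Measure Ω)
    (X : Ω → ℕ → Path) (a : ℕ) : Prop :=
  ¬ InfinitelyVisited P X a ∧ ¬ OnceVisited P X a ∧ ¬ NeverVisited P X a

def sigmaX {Ω : Type*} (X : Ω → ℕ → Path) : MeasurableSpace Ω :=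
  MeasurableSpace.comap X inferInstance

def tailVMC {Ω : Type*} (X : Ω → ℕ → Path) : MeasurableSpace Ω :=
  ⨅ N : ℕ, MeasurableSpace.comap (fun ω (M : ℕ) => X ω (N + M)) inferInstance

def TailTrivial {Ω : Type*} [MeasurableSpace Ω] (P : Measure Ω) (X : Ω → ℕ → Path) : Prop :=
  ∀ A : Set Ω, MeasurableSet[tailVMC X] A → P A = 0 ∨ P A = 1

def RepresentedBy {Ω : Type*} [MeasurableSpace Ω] (P : Measure Ω) (X : Ω → ℕ → Path)
    (ν : ℕ → ℕ → ℝ) (K : ℕ → ℕ → ℕ → ℝ) : Prop :=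
  (∀ N a, a ≤ N → (P {ω | X ω N 0 = a}).toReal = ν N a) ∧
  ∀ N a b, a ≤ N → b ≤ N → 0 < (P {ω | X ω N 0 = a}).toReal →
    (P {ω | X ω N 0 = a ∧ X ω N 1 = b}).toReal / (P {ω | X ω N 0 = a}).toReal = K N a b

noncomputable def piK (K : ℕ → ℕ → ℕ → ℝ) (N : ℕ) (b : ℕ) : ℝ :=
  if K (N + 1) (N + 1) (N + 1) < 1 then
    K (N + 1) (N + 1) b / (1 - K (N + 1) (N + 1) (N + 1))
  else if b = 0 then 1 else 0

def IsVTM (K : ℕ → ℕ → ℕ → ℝ) : Prop :=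
  (∀ N a b, 0 ≤ K N a b) ∧
  (∀ N a b, a ≤ N → N < b → K N a b = 0) ∧
  (∀ N a, a ≤ N → ∑ b ∈ Finset.range (N + 1), K N a b = 1) ∧
  (∀ N, K N 0 0 = 1) ∧
  (∀ N a b, a ≤ N → b ≤ N → K N a b = K (N + 1) a b + K (N + 1) a (N + 1) * piK K N b)

def mpow (N : ℕ) (M : ℕ → ℕ → ℝ) : ℕ → ℕ → ℕ → ℝ
  | 0 => fun a b => if a = b then 1 else 0
  | n + 1 => fun a b => ∑ c ∈ Finset.range (N + 1), mpow N M n a c * M c b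

def IsIrreducibleVTM (K : ℕ → ℕ → ℕ → ℝ) : Prop :=
  ∀ N, 1 ≤ N → ∀ a b, 1 ≤ a → a ≤ N → 1 ≤ b → b ≤ N →
    ∃ n, 0 < mpow N (K N) n a b

def IsClassical {Ω : Type*} [MeasurableSpace Ω] (P : Measure Ω) (X : Ω → ℕ → Path) : Prop :=
  ∀ᵐ ω ∂P, ∃ x : Path, x ∈ fullPathSpace ∧
    (∀ i, ∀ᶠ N in atTop, X ω N i = x i) ∧ ∀ N, X ω N = proj N x


open ProbabilityTheory Topology

lemma meas_all (s : Set ℕ) (N : ℕ) : MeasurableSet {S : Path | S N ∈ s} :=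
  (measurable_pi_apply N) (MeasurableSet.of_discrete (s := s))

lemma meas_eq (N a : ℕ) : MeasurableSet {S : Path | S N = a} := meas_all {a} N

lemma meas_joint (N a b : ℕ) : MeasurableSet {S : Path | S N = a ∧ S (N + 1) = b} :=
  (meas_eq N a).inter (meas_eq (N + 1) b)

def cyl (N : ℕ) (a : ℕ → ℕ) : Set Path := {S | ∀ i ≤ N, S i = a i}

lemma meas_cyl (N : ℕ) (a : ℕ → ℕ) : MeasurableSet (cyl N a) := by
  have : cyl N a = ⋂ i, ⋂ (_ : i ≤ N), {S : Path | S i = a i} := by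
    ext S; simp [cyl]
  rw [this]
  exact MeasurableSet.iInter fun i => MeasurableSet.iInter fun _ => meas_eq i _

lemma isClopen_coord (N a : ℕ) : IsClopen {S : Path | S N = a} := by
  have hc : Continuous (fun S : Path => S N) := continuous_apply N
  exact (isClopen_discrete ({a} : Set ℕ)).preimage hc

lemma isOpen_coord (N a : ℕ) : IsOpen {S : Path | S N = a} := (isClopen_coord N a).isOpen

lemma isOpen_cyl (N : ℕ) (a : ℕ → ℕ) : IsOpen (cyl N a) := by
  have : cyl N a = ⋂ i ∈ Set.Iic N, {S : Path | S i = a i} := by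
    ext S; simp [cyl]
  rw [this]
  exact (Set.finite_Iic N).isOpen_biInter fun i _ => isOpen_coord i _

def cyls : Set (Set Path) := {s | ∃ N a, s = cyl N a}

lemma cyls_pi : IsPiSystem cyls := by
  rintro _ ⟨N, a, rfl⟩ _ ⟨M, b, rfl⟩ ⟨x, hx, hy⟩
  refine ⟨max N M, x, ?_⟩
  ext S
  simp only [cyl, Set.mem_inter_iff, Set.mem_ofPred_eq] at *
  constructor
  · rintro ⟨h1, h2⟩ i hi
    rcases le_max_iff.1 hi with h | h
    · rw [h1 i h, hx i h]
    · rw [h2 i h, hy i h]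
  · intro h
    exact ⟨fun i hi => by rw [h i (le_max_of_le_left hi), hx i hi],
      fun i hi => by rw [h i (le_max_of_le_right hi), hy i hi]⟩

lemma cyls_nhds (u : Set Path) (hu : IsOpen u) (x : Path) (hx : x ∈ u) :
    ∃ s ∈ cyls, s ∈ 𝓝 x ∧ s ⊆ u := by
  obtain ⟨I, v, hv, hI⟩ := isOpen_pi_iff.1 hu x hx
  refine ⟨cyl (I.sup id) x, ⟨_, _, rfl⟩, (isOpen_cyl _ _).mem_nhds (fun i _ => rfl), ?_⟩
  intro S hS
  apply hI
  intro i hi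
  have : S i = x i := hS i (Finset.le_sup (f := id) hi)
  rw [this]
  exact (hv i hi).2

/-- backward kernel -/
noncomputable def Bk (π : ℕ → ℕ → ℝ) (N a b : ℕ) : ℝ :=
  if b = N + 1 then π N a else if a = b then 1 else 0

noncomputable def cw (π : ℕ → ℕ → ℝ) (a : ℕ → ℕ) : ℕ → ℝ
  | 0 => 1
  | N + 1 => cw π a N * Bk π N (a N) (a (N + 1))

lemma ae_stair {μ : Measure Path} [IsProbabilityMeasure μ] (h : μ staircaseSet = 1) :
    ∀ᵐ S ∂μ, S ∈ staircaseSet := by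
  have hm : MeasurableSet staircaseSet := by
    have : staircaseSet = (⋂ N, {S : Path | S N ∈ Set.Iic N}) ∩
        ⋂ N, ({S : Path | S (N + 1) = S N} ∪ {S : Path | S (N + 1) = N + 1}) := by
      ext S; simp [staircaseSet]
    rw [this]
    refine (MeasurableSet.iInter fun N => meas_all _ _).inter
      (MeasurableSet.iInter fun N => MeasurableSet.union ?_ (meas_eq _ _))
    exact measurableSet_eq_fun (measurable_pi_apply _) (measurable_pi_apply _)
  exact (prob_compl_eq_zero_iff hm).2 h

/-- measures with backward structure -/
structure Good (π : ℕ → ℕ → ℝ) (μ : Measure Path) : Prop where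
  prob : IsProbabilityMeasure μ
  stair : μ staircaseSet = 1
  joint : ∀ N a b, pr μ {S | S N = a ∧ S (N + 1) = b} = pr μ {S | S (N + 1) = b} * Bk π N a b
  cy : ∀ N a, pr μ (cyl N a) = pr μ {S | S N = a N} * cw π a N

lemma good_of_mem {π : ℕ → ℕ → ℝ} (hπ : IsBalayage π) {μ : Measure Path} (h : μ ∈ PMCpi π) :
    Good π μ := by
  obtain ⟨⟨hp, hs, hM⟩, hb⟩ := h
  have hae := ae_stair hs
  have hj : ∀ N a b, pr μ {S | S N = a ∧ S (N + 1) = b}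
      = pr μ {S | S (N + 1) = b} * Bk π N a b := by
    intro N a b
    unfold Bk
    split_ifs with h1 h2
    · subst h1
      by_cases haN : a ≤ N
      · by_cases h0 : 0 < pr μ {S | S (N + 1) = N + 1}
        · rw [← hb N a haN h0]; field_simp
        · have h0' : pr μ {S | S (N + 1) = N + 1} = 0 :=
            le_antisymm (not_lt.1 h0) ENNReal.toReal_nonneg
          rw [h0', zero_mul]
          refine le_antisymm ?_ ENNReal.toReal_nonneg
          rw [← h0']
          exact measureReal_mono (μ := μ) (fun S hS => hS.2)
      · rw [hπ.2.1 N a (not_le.1 haN), mul_zero]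
        have : μ {S | S N = a ∧ S (N + 1) = N + 1} = 0 := by
          refine measure_mono_null ?_ hae
          rintro S ⟨hS, _⟩ hS'
          exact haN (hS ▸ hS'.1 N)
        simp [pr, this]
    · subst h2
      rw [mul_one]
      unfold pr
      congr 1
      refine measure_congr ?_
      filter_upwards [hae] with S hS
      refine propext ⟨fun h => h.2, fun h => ⟨?_, h⟩⟩
      have h : S (N + 1) = a := h
      rcases hS.2 N with h' | h'
      · rw [← h', h]
      · exact absurd (h.symm.trans h') h1
    · rw [mul_zero]
      have : μ {S | S N = a ∧ S (N + 1) = b} = 0 := by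
        refine measure_mono_null ?_ hae
        rintro S ⟨hS, hSb⟩ hS'
        rcases hS'.2 N with h' | h'
        · exact h2 (hS.symm.trans (h'.symm.trans hSb))
        · exact h1 (hSb.symm.trans h')
      simp [pr, this]
  refine ⟨hp, hs, hj, ?_⟩
  intro N
  induction N with
  | zero =>
    intro a
    simp [cyl, cw]
  | succ N ih =>
    intro a
    have e : cyl (N + 1) a = {S | (∀ i ≤ N, S i = a i) ∧ S (N + 1) = a (N + 1)} := by
      ext S
      simp only [cyl, Set.mem_ofPred_eq]
      constructor
      · exact fun h => ⟨fun i hi => h i (by omega), h _ le_rfl⟩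
      · rintro ⟨h1, h2⟩ i hi
        rcases Nat.le_succ_iff.1 hi with h | h
        · exact h1 i h
        · rw [h]; exact h2
    have hi := ih a
    by_cases h0 : 0 < pr μ (cyl N a)
    · have hm := hM N a h0
      rw [← e] at hm
      change _ / pr μ (cyl N a) = _ at hm
      rw [hj, div_eq_iff h0.ne', hi] at hm
      have hne : pr μ {S | S N = a N} ≠ 0 := by
        intro hz; rw [hi, hz, zero_mul] at h0; exact lt_irrefl _ h0
      rw [hm, cw]; field_simp
    · have h0' : pr μ (cyl N a) = 0 := le_antisymm (not_lt.1 h0) ENNReal.toReal_nonneg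
      have : pr μ (cyl (N + 1) a) = 0 := by
        refine le_antisymm ?_ ENNReal.toReal_nonneg
        rw [← h0']
        exact measureReal_mono (μ := μ) (fun S hS i hi => hS i (by omega))
      rw [this, cw]
      rw [h0'] at hi
      rcases mul_eq_zero.1 hi.symm with h | h
      · have hz : pr μ {S | S N = a N ∧ S (N + 1) = a (N + 1)} = 0 := by
          refine le_antisymm ?_ ENNReal.toReal_nonneg
          rw [← h]
          exact measureReal_mono (μ := μ) (fun S hS => hS.1)
        rw [hj] at hz
        rw [mul_left_comm, hz, mul_zero]
      · rw [h]; simp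

lemma mem_of_good {π : ℕ → ℕ → ℝ} {μ : Measure Path} (h : Good π μ) : μ ∈ PMCpi π := by
  refine ⟨⟨h.prob, h.stair, ?_⟩, ?_⟩
  · intro N a h0
    have e : {S : Path | (∀ i ≤ N, S i = a i) ∧ S (N + 1) = a (N + 1)} = cyl (N + 1) a := by
      ext S
      simp only [cyl, Set.mem_ofPred_eq]
      constructor
      · rintro ⟨h1, h2⟩ i hi
        rcases Nat.le_succ_iff.1 hi with h | h
        · exact h1 i h
        · rw [h]; exact h2
      · exact fun h => ⟨fun i hi => h i (by omega), h _ le_rfl⟩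
    change 0 < pr μ (cyl N a) at h0
    change _ / pr μ (cyl N a) = _
    rw [e, h.joint, h.cy, h.cy, cw]
    rw [h.cy] at h0
    have h1 := left_ne_zero_of_mul h0.ne'
    have h2 := right_ne_zero_of_mul h0.ne'
    field_simp
  · intro N a _ h0
    rw [h.joint, Bk, if_pos rfl]
    field_simp

lemma sum_marg {μ : Measure Path} [IsProbabilityMeasure μ] (h : μ staircaseSet = 1) (N : ℕ) :
    ∑ a ∈ Finset.range (N + 1), marginals μ N a = 1 := by
  have hae := ae_stair h
  have h1 := measureReal_biUnion_finset (μ := μ) (s := Finset.range (N + 1))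
    (f := fun a => {S : Path | S N = a})
    (fun a _ b _ hab => Set.disjoint_left.2 fun S hS hS' => hab (hS.symm.trans hS'))
    (fun b _ => meas_eq N b)
  refine h1.symm.trans ?_
  have : μ (⋃ b ∈ Finset.range (N + 1), {S : Path | S N = b}) = μ Set.univ := by
    refine measure_congr ?_
    filter_upwards [hae] with S hS
    refine propext ⟨fun _ => trivial, fun _ => ?_⟩
    refine Set.mem_iUnion₂.2 ⟨S N, ?_, rfl⟩
    have := hS.1 N
    simp; omega
  rw [Measure.real, this, measure_univ, ENNReal.toReal_one]

lemma marg_mem {π : ℕ → ℕ → ℝ} (hπ : IsBalayage π) {μ : Measure Path} (h : Good π μ) :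
    marginals μ ∈ Dpi π := by
  have := h.prob
  have hae := ae_stair h.stair
  have key : ∀ N a, a ≤ N → marginals μ N a
      = marginals μ (N + 1) a + marginals μ (N + 1) (N + 1) * π N a := by
    intro N a ha
    have h1 := h.joint N a a
    have h2 := h.joint N a (N + 1)
    rw [Bk, if_neg (by omega), if_pos rfl, mul_one] at h1
    rw [Bk, if_pos rfl] at h2
    unfold marginals
    rw [← h1, ← h2]
    have : μ.real {S | S N = a} = μ.real ({S | S N = a ∧ S (N + 1) = a} ∪
        {S | S N = a ∧ S (N + 1) = N + 1}) := by
      refine measureReal_congr ?_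
      filter_upwards [hae] with S hS
      refine propext ⟨fun hh => ?_, fun hh => hh.elim (fun h => h.1) (fun h => h.1)⟩
      have hh : S N = a := hh
      rcases hS.2 N with h' | h'
      · exact Or.inl ⟨hh, h'.trans hh⟩
      · exact Or.inr ⟨hh, h'⟩
    rw [measureReal_union _ (meas_joint _ _ _)] at this
    · exact this
    · rw [Set.disjoint_left]
      rintro S ⟨_, hS⟩ ⟨_, hS'⟩
      omega
  refine ⟨⟨fun N a => ENNReal.toReal_nonneg, ?_, ?_, ?_⟩, key⟩
  · intro N a ha
    have : μ {S | S N = a} = 0 := by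
      refine measure_mono_null ?_ hae
      intro S hS hS'
      have h1 : S N = a := hS
      have h2 := hS'.1 N
      omega
    simp [marginals, pr, this]
  · exact sum_marg h.stair
  · intro N a ha
    rw [key N a ha]
    have h1 : 0 ≤ marginals μ (N + 1) (N + 1) := ENNReal.toReal_nonneg
    have := mul_nonneg h1 (hπ.1 N a)
    linarith

lemma pr_mix {μ₁ μ₂ : Measure Path} [IsProbabilityMeasure μ₁] [IsProbabilityMeasure μ₂]
    {t : ℝ≥0∞} (ht : t ≤ 1) (A : Set Path) :
    pr (t • μ₁ + (1 - t) • μ₂) A = t.toReal * pr μ₁ A + (1 - t.toReal) * pr μ₂ A := by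
  have ht' : t ≠ ∞ := ne_top_of_le_ne_top ENNReal.one_ne_top ht
  have h1 : (1 - t) ≠ ∞ := ne_top_of_le_ne_top ENNReal.one_ne_top tsub_le_self
  unfold pr
  rw [Measure.add_apply, Measure.smul_apply, Measure.smul_apply, smul_eq_mul, smul_eq_mul,
    ENNReal.toReal_add (ENNReal.mul_ne_top ht' (measure_ne_top _ _))
      (ENNReal.mul_ne_top h1 (measure_ne_top _ _)), ENNReal.toReal_mul, ENNReal.toReal_mul,
    ENNReal.toReal_sub_of_le ht ENNReal.one_ne_top, ENNReal.toReal_one]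

lemma good_mix {π : ℕ → ℕ → ℝ} {μ₁ μ₂ : Measure Path} (h1 : Good π μ₁) (h2 : Good π μ₂)
    {t : ℝ≥0∞} (ht : t ≤ 1) : Good π (t • μ₁ + (1 - t) • μ₂) := by
  have := h1.prob
  have := h2.prob
  refine ⟨⟨?_⟩, ?_, ?_, ?_⟩
  · simp [ht]
  · simp [h1.stair, h2.stair, ht]
  · intro N a b
    rw [pr_mix ht, pr_mix ht, h1.joint, h2.joint]; ring
  · intro N a
    rw [pr_mix ht, pr_mix ht, h1.cy, h2.cy]; ring

/-- existence of Markov chains -/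
lemma exists_chain (p : ℕ → ℕ → Measure ℕ) (hp : ∀ N a, IsProbabilityMeasure (p N a)) :
    ∃ μ : Measure Path, IsProbabilityMeasure μ ∧ μ {S | S 0 = 0} = 1 ∧
      ∀ N a b (A : Set Path), (∀ S ∈ A, S N = a) →
        (∀ S T : Path, (∀ i ≤ N, S i = T i) → S ∈ A → T ∈ A) →
        μ (A ∩ {S | S (N + 1) = b}) = μ A * p N a {b} := by
  let κ : (n : ℕ) → Kernel (Π i : Finset.Iic n, (fun _ : ℕ => ℕ) i) ((fun _ : ℕ => ℕ) (n + 1)) :=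
    fun n => ⟨fun x => p n (x ⟨n, by simp⟩), by
      exact (Measurable.of_discrete (f := p n)).comp (measurable_pi_apply _)⟩
  have hκ : ∀ n, IsMarkovKernel (κ n) := fun n => ⟨fun x => hp n _⟩
  let x₀ : Π i : Finset.Iic 0, (fun _ : ℕ => ℕ) i := fun _ => 0
  refine ⟨Kernel.traj (X := fun _ : ℕ => ℕ) κ 0 x₀, inferInstance, ?_, ?_⟩
  · have h := Kernel.traj_map_frestrictLe_apply (X := fun _ : ℕ => ℕ) (κ := κ) 0 0 x₀
    have e : {S : Path | S 0 = 0} = Preorder.frestrictLe 0 ⁻¹'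
        {x : Π i : Finset.Iic 0, (fun _ : ℕ => ℕ) i | x ⟨0, by simp⟩ = 0} := rfl
    have hm : MeasurableSet {x : Π i : Finset.Iic 0, (fun _ : ℕ => ℕ) i | x ⟨0, by simp⟩ = 0} :=
      MeasurableSet.of_discrete
    rw [e, ← Measure.map_apply (by fun_prop) hm, h, Kernel.partialTraj_self, Kernel.id_apply,
      Measure.dirac_apply' _ hm]
    simp [x₀]
  · intro N a b A hA hA'
    set μ := Kernel.traj (X := fun _ : ℕ => ℕ) κ 0 x₀ with hμ
    have h := Kernel.partialTraj_compProd_eq_map_traj (X := fun _ : ℕ => ℕ) (κ := κ) (Nat.zero_le N) (x₀ := x₀)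
    let B : Set (Π i : Finset.Iic N, (fun _ : ℕ => ℕ) i) := {x | ∃ S ∈ A, Preorder.frestrictLe N S = x}
    have hB : MeasurableSet B := MeasurableSet.of_discrete
    have eA : A = Preorder.frestrictLe N ⁻¹' B := by
      ext S
      refine ⟨fun hS => ⟨S, hS, rfl⟩, ?_⟩
      rintro ⟨T, hT, hTS⟩
      exact hA' T S (fun i hi => congrFun hTS ⟨i, by simpa using hi⟩) hT
    have e2 : A ∩ {S : Path | S (N + 1) = b} =
        (fun x : Path => (Preorder.frestrictLe (π := fun _ : ℕ => ℕ) N x, x (N + 1))) ⁻¹' (B ×ˢ {b}) := by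
      conv_lhs => rw [eA]
      rfl
    have hb : MeasurableSet ({b} : Set ℕ) := MeasurableSet.of_discrete
    have h3 : μ (A ∩ {S : Path | S (N + 1) = b}) = ∫⁻ x in B, κ N x {b} ∂(Kernel.partialTraj (X := fun _ : ℕ => ℕ) κ 0 N x₀) := by
      rw [e2, ← Measure.map_apply (by fun_prop) (hB.prod hb), hμ, ← h]
      exact Measure.compProd_apply_prod hB hb
    have h4 : ∫⁻ x in B, κ N x {b} ∂(Kernel.partialTraj (X := fun _ : ℕ => ℕ) κ 0 N x₀)
        = ∫⁻ x in B, p N a {b} ∂(Kernel.partialTraj (X := fun _ : ℕ => ℕ) κ 0 N x₀) := by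
      refine setLIntegral_congr_fun hB ?_
      rintro x ⟨S, hS, rfl⟩
      change p N (S N) {b} = _
      rw [hA S hS]
    rw [h3, h4, setLIntegral_const, mul_comm]
    congr 1
    rw [← Kernel.traj_map_frestrictLe_apply, Measure.map_apply (by fun_prop) hB, ← eA]

noncomputable def qj (π ν : ℕ → ℕ → ℝ) (N a : ℕ) : ℝ := ν (N + 1) (N + 1) * π N a / ν N a

lemma exists_of_D {π ν : ℕ → ℕ → ℝ} (hπ : IsBalayage π) (hν : ν ∈ Dpi π) :
    ∃ μ : Measure Path, μ ∈ PMCpi π ∧ marginals μ = ν := by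
  obtain ⟨⟨h0, hsupp, hsum, hmono⟩, hrec⟩ := hν
  have hq0 : ∀ N a, 0 ≤ qj π ν N a := fun N a =>
    div_nonneg (mul_nonneg (h0 _ _) (hπ.1 _ _)) (h0 _ _)
  have hq1 : ∀ N a, qj π ν N a ≤ 1 := by
    intro N a
    refine div_le_one_of_le₀ ?_ (h0 _ _)
    by_cases ha : a ≤ N
    · rw [hrec N a ha]; linarith [h0 (N + 1) a]
    · rw [hπ.2.1 N a (not_le.1 ha), mul_zero]; exact h0 _ _
  have hνq : ∀ N a, a ≤ N → ν N a * qj π ν N a = ν (N + 1) (N + 1) * π N a := by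
    intro N a ha
    by_cases hz : ν N a = 0
    · have h1 := hrec N a ha
      have h2 := h0 (N + 1) a
      have h3 := mul_nonneg (h0 (N + 1) (N + 1)) (hπ.1 N a)
      rw [hz, zero_mul]; linarith
    · unfold qj; field_simp
  let p : ℕ → ℕ → Measure ℕ := fun N a =>
    ENNReal.ofReal (qj π ν N a) • Measure.dirac (N + 1)
      + ENNReal.ofReal (1 - qj π ν N a) • Measure.dirac a
  have hp : ∀ N a, IsProbabilityMeasure (p N a) := by
    intro N a
    constructor
    simp only [p, Measure.add_apply, Measure.smul_apply, measure_univ, smul_eq_mul, mul_one]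
    rw [← ENNReal.ofReal_add (hq0 _ _) (by linarith [hq1 N a])]
    simp
  let R : ℕ → ℕ → ℕ → ℝ := fun N a b =>
    qj π ν N a * (if b = N + 1 then 1 else 0) + (1 - qj π ν N a) * (if b = a then 1 else 0)
  have hpR : ∀ N a b, (p N a {b}).toReal = R N a b := by
    intro N a b
    have e1 : (Measure.dirac (N + 1) ({b} : Set ℕ)) = if b = N + 1 then 1 else 0 := by
      rw [Measure.dirac_apply' _ MeasurableSet.of_discrete]
      simp [Set.indicator, eq_comm]
    have e2 : (Measure.dirac a ({b} : Set ℕ)) = if b = a then 1 else 0 := by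
      rw [Measure.dirac_apply' _ MeasurableSet.of_discrete]
      simp [Set.indicator, eq_comm]
    simp only [p, R, Measure.add_apply, Measure.smul_apply, smul_eq_mul, e1, e2]
    rw [ENNReal.toReal_add (by split_ifs <;> simp) (by split_ifs <;> simp),
      ENNReal.toReal_mul, ENNReal.toReal_mul, ENNReal.toReal_ofReal (hq0 _ _),
      ENNReal.toReal_ofReal (by linarith [hq1 N a])]
    split_ifs <;> simp
  obtain ⟨μ, hμ, hμ0, hch⟩ := exists_chain p hp
  have hchR : ∀ N a b (A : Set Path), (∀ S ∈ A, S N = a) →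
        (∀ S T : Path, (∀ i ≤ N, S i = T i) → S ∈ A → T ∈ A) →
        pr μ (A ∩ {S | S (N + 1) = b}) = pr μ A * R N a b := by
    intro N a b A hA hA'
    unfold pr
    rw [hch N a b A hA hA', ENNReal.toReal_mul, hpR]
  have hJ : ∀ N a b, pr μ {S | S N = a ∧ S (N + 1) = b} = pr μ {S | S N = a} * R N a b :=
    fun N a b => hchR N a b {S | S N = a} (fun S hS => hS)
      (fun S T hST hS => (hST N le_rfl).symm.trans hS)
  have hae0 : ∀ᵐ S ∂μ, S 0 = 0 := (prob_compl_eq_zero_iff (meas_eq 0 0)).2 hμ0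
  have haeN : ∀ᵐ S ∂μ, ∀ N, S (N + 1) = S N ∨ S (N + 1) = N + 1 := by
    rw [ae_all_iff]
    intro N
    have : ∀ᵐ S ∂μ, ∀ a b, b ≠ a → b ≠ N + 1 → ¬ (S N = a ∧ S (N + 1) = b) := by
      simp only [ae_all_iff]
      intro a b h1 h2
      have hz : pr μ {S | S N = a ∧ S (N + 1) = b} = 0 := by
        rw [hJ]; simp [R, h1, h2]
      have hz' : μ {S | S N = a ∧ S (N + 1) = b} = 0 :=
        ((ENNReal.toReal_eq_zero_iff _).1 hz).resolve_right (measure_ne_top _ _)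
      exact measure_eq_zero_iff_ae_notMem.1 hz'
    filter_upwards [this] with S hS
    by_contra hcon
    push Not at hcon
    exact hS (S N) (S (N + 1)) hcon.1 hcon.2 ⟨rfl, rfl⟩
  have hstair_ae : ∀ᵐ S ∂μ, S ∈ staircaseSet := by
    filter_upwards [hae0, haeN] with S h1 h2
    refine ⟨fun N => ?_, h2⟩
    induction N with
    | zero => exact h1.le
    | succ N ih => rcases h2 N with h | h <;> omega
  have hstair : μ staircaseSet = 1 := by
    have h1 : μ staircaseSet = μ Set.univ := by
      refine measure_congr ?_
      filter_upwards [hstair_ae] with S hS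
      exact propext ⟨fun _ => trivial, fun _ => hS⟩
    rw [h1, measure_univ]
  have hsuppμ : ∀ N a, N < a → marginals μ N a = 0 := by
    intro N a ha
    have : μ {S | S N = a} = 0 := by
      refine measure_mono_null ?_ hstair_ae
      intro S hS hS'
      have h1 : S N = a := hS
      have h2 := hS'.1 N
      omega
    simp [marginals, pr, this]
  have hm : ∀ N a, marginals μ N a = ν N a := by
    intro N
    induction N with
    | zero =>
      intro a
      by_cases ha : a = 0
      · subst ha
        have h1 := hsum 0
        have h2 := sum_marg hstair 0
        simp only [zero_add, Finset.sum_range_one] at h1 h2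
        rw [h1, h2]
      · rw [hsuppμ 0 a (by omega), hsupp 0 a (by omega)]
    | succ N ih =>
      have hle : ∀ b, b ≤ N → marginals μ (N + 1) b = ν (N + 1) b := by
        intro b hb
        have e : pr μ {S | S (N + 1) = b} = pr μ {S | S N = b ∧ S (N + 1) = b} := by
          unfold pr
          congr 1
          refine measure_congr ?_
          filter_upwards [haeN] with S hS
          refine propext ⟨fun h => ⟨?_, h⟩, fun h => h.2⟩
          have h : S (N + 1) = b := h
          rcases hS N with h' | h' <;> omega
        have h1 : pr μ {S | S N = b} = ν N b := ih b
        have h2 := hνq N b hb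
        have h3 := hrec N b hb
        change pr μ {S | S (N + 1) = b} = _
        rw [e, hJ, h1]
        have : b ≠ N + 1 := by omega
        simp only [R, this, if_false, if_true]
        linarith
      intro b
      rcases lt_trichotomy b (N + 1) with h | h | h
      · exact hle b (by omega)
      · subst h
        have h1 := hsum (N + 1)
        have h2 := sum_marg hstair (N + 1)
        rw [Finset.sum_range_succ] at h1 h2
        rw [Finset.sum_congr rfl (fun x hx => hle x (by simp at hx; omega))] at h2
        linarith
      · rw [hsuppμ _ _ h, hsupp _ _ h]
  refine ⟨μ, ⟨⟨hμ, hstair, ?_⟩, ?_⟩, funext fun N => funext fun a => hm N a⟩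
  · intro N a hpos
    have h1 := hchR N (a N) (a (N + 1)) {S | ∀ i ≤ N, S i = a i} (fun S hS => hS N le_rfl)
      (fun S T hST hS i hi => (hST i hi).symm.trans (hS i hi))
    have h2 : 0 < pr μ {S | S N = a N} :=
      hpos.trans_le (measureReal_mono (μ := μ) (fun S hS => hS N le_rfl))
    change pr μ ({S | ∀ i ≤ N, S i = a i} ∩ {S | S (N + 1) = a (N + 1)}) / _ = _
    rw [h1, hJ, mul_div_cancel_left₀ _ hpos.ne', mul_div_cancel_left₀ _ h2.ne']
  · intro N a ha hpos
    have h1 : pr μ {S | S N = a} = ν N a := hm N a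
    have h2 : pr μ {S | S (N + 1) = N + 1} = ν (N + 1) (N + 1) := hm (N + 1) (N + 1)
    rw [h2] at hpos
    rw [hJ, h1, h2, div_eq_iff hpos.ne']
    have : N + 1 ≠ a := by omega
    simp only [R, this, if_false, if_true]
    have := hνq N a ha
    linarith

lemma tendsto_of_marg {π : ℕ → ℕ → ℝ} {ι : Type*} {l : Filter ι} [l.IsCountablyGenerated]
    {μ : ι → ProbabilityMeasure Path} {μ₀ : ProbabilityMeasure Path}
    (h : ∀ i, Good π (μ i : Measure Path)) (h₀ : Good π (μ₀ : Measure Path))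
    (hl : ∀ N a, Tendsto (fun i => marginals (μ i : Measure Path) N a) l
      (𝓝 (marginals (μ₀ : Measure Path) N a))) : Tendsto μ l (𝓝 μ₀) := by
  refine cyls_pi.tendsto_probabilityMeasure_of_tendsto_of_mem ?_ cyls_nhds ?_
  · rintro _ ⟨N, a, rfl⟩
    exact meas_cyl N a
  · rintro _ ⟨N, a, rfl⟩
    rw [← NNReal.tendsto_coe]
    have h1 : ∀ i, ((μ i (cyl N a) : ℝ≥0) : ℝ) = marginals (μ i : Measure Path) N (a N) * cw π a N :=
      fun i => (h i).cy N a
    have h2 : ((μ₀ (cyl N a) : ℝ≥0) : ℝ) = marginals (μ₀ : Measure Path) N (a N) * cw π a N :=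
      h₀.cy N a
    simp only [h1, h2]
    exact (hl N (a N)).mul_const _

lemma continuous_marg :
    Continuous (fun μ : ProbabilityMeasure Path => marginals (μ : Measure Path)) := by
  refine continuous_pi fun N => continuous_pi fun a => ?_
  rw [continuous_iff_continuousAt]
  intro μ
  have h := ProbabilityMeasure.tendsto_measure_of_null_frontier_of_tendsto
    (μs := fun m : ProbabilityMeasure Path => m) (μ := μ) (L := 𝓝 μ) tendsto_id
    (E := {S : Path | S N = a}) (by rw [(isClopen_coord N a).frontier_eq]; simp)
  exact (NNReal.tendsto_coe.2 h)

/-- for every balayage `π`, the marginal map `Φ` maps `P_MC^π(𝒮)` bijectively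
onto `𝒟(π)`, is affine, and the restriction is a homeomorphism. -/
theorem statement3 (π : ℕ → ℕ → ℝ) (hπ : IsBalayage π) :
    (∀ μ ∈ PMCpi π, marginals μ ∈ Dpi π) ∧
    (∀ μ₁ ∈ PMCpi π, ∀ μ₂ ∈ PMCpi π, ∀ t : ℝ≥0∞, t ≤ 1 →
      (t • μ₁ + (1 - t) • μ₂) ∈ PMCpi π ∧
      marginals (t • μ₁ + (1 - t) • μ₂)
        = t.toReal • marginals μ₁ + (1 - t.toReal) • marginals μ₂) ∧
    ∃ e : {μ : ProbabilityMeasure Path | (μ : Measure Path) ∈ PMCpi π} ≃ₜ Dpi π,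
      ∀ μ, (e μ : ℕ → ℕ → ℝ)
        = marginals ((μ : ProbabilityMeasure Path) : Measure Path) := by
  refine ⟨fun μ hμ => marg_mem hπ (good_of_mem hπ hμ), ?_, ?_⟩
  · intro μ₁ h₁ μ₂ h₂ t ht
    have g₁ := good_of_mem hπ h₁
    have g₂ := good_of_mem hπ h₂
    refine ⟨mem_of_good (good_mix g₁ g₂ ht), ?_⟩
    have := g₁.prob
    have := g₂.prob
    funext N a
    exact pr_mix ht _
  · let f : {μ : ProbabilityMeasure Path | (μ : Measure Path) ∈ PMCpi π} → Dpi π :=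
      fun μ => ⟨marginals ((μ : ProbabilityMeasure Path) : Measure Path),
        marg_mem hπ (good_of_mem hπ μ.2)⟩
    have hinj : Function.Injective f := by
      intro μ₁ μ₂ h
      have h : marginals (μ₁.1 : Measure Path) = marginals (μ₂.1 : Measure Path) :=
        congrArg Subtype.val h
      have ht : Tendsto (fun _ : ℕ => μ₁.1) atTop (𝓝 μ₂.1) :=
        tendsto_of_marg (π := π) (fun _ => good_of_mem hπ μ₁.2) (good_of_mem hπ μ₂.2)
          (fun N a => by rw [h]; exact tendsto_const_nhds)
      exact Subtype.ext (tendsto_nhds_unique tendsto_const_nhds ht)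
    have hsurj : Function.Surjective f := by
      rintro ⟨ν, hν⟩
      obtain ⟨μ, hμ, hm⟩ := exists_of_D hπ hν
      exact ⟨⟨⟨μ, hμ.1.1⟩, hμ⟩, Subtype.ext hm⟩
    let E := Equiv.ofBijective f ⟨hinj, hsurj⟩
    have hE : ∀ ν : Dpi π, marginals ((E.symm ν).1 : Measure Path) = ν.1 := fun ν =>
      congrArg Subtype.val (E.apply_symm_apply ν)
    refine ⟨⟨E, ?_, ?_⟩, fun μ => rfl⟩
    · exact (continuous_marg.comp continuous_subtype_val).subtype_mk _
    · refine Continuous.subtype_mk (f := fun ν => (E.symm ν).1) ?_ (fun ν => (E.symm ν).2)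
      rw [continuous_iff_continuousAt]
      intro ν₀
      refine tendsto_of_marg (π := π) (fun ν => good_of_mem hπ (E.symm ν).2)
        (good_of_mem hπ (E.symm ν₀).2) (fun N a => ?_)
      simp only [hE]
      have : Continuous (fun ν : Dpi π => ν.1 N a) :=
        (continuous_apply a).comp ((continuous_apply N).comp continuous_subtype_val)
      exact this.tendsto ν₀

end VMCPaper
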